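/- arXiv:2008.09905 — 2 statements merged into one kernel-verified Lean document; each statement's English description precedes it below -/
import Mathlib

section
/- For a polynomial f ∈ F_q[u] with q odd, Pellet's formula holds: μ(f) = (-1)^{deg f} · χ₂(Δ(f)), where μ is the Möbius function on F_q[u], Δ(f) is the discriminant of f, and χ₂ is the quadratic character of F_q (extended by χ₂(0)=0). -/
open scoped Classical

/-- The Möbius function of `F_q[u]`: zero on polynomials divisible by the square of a
nonconstant polynomial, and `(-1)^r` on a squarefree polynomial with `r` irreducible
factors. -/
noncomputable def polyMoebius {F : Type*} [Field F] (f : Polynomial F) : ℤ :=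
  if Squarefree f then (-1) ^ (UniqueFactorizationMonoid.factors f).card else 0

namespace Equiv.Perm

variable {ι κ : Type*}

/-- The sign of a transitive permutation. -/
theorem sign_of_forall_sameCycle [Fintype ι] [DecidableEq ι] [Nonempty ι] (σ : Perm ι)
    (h : ∀ i j, σ.SameCycle i j) : sign σ = (-1) ^ (Fintype.card ι + 1) := by
  obtain hι | hι := subsingleton_or_nontrivial ι
  · have hcard : Fintype.card ι = 1 :=
      le_antisymm (Fintype.card_le_one_iff_subsingleton.2 hι) Fintype.card_pos
    simp [Subsingleton.elim σ 1, hcard]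
  · have hne (i : ι) : σ i ≠ i := fun hi ↦ by
      obtain ⟨j, hj⟩ := exists_ne i
      exact hj ((h i j).eq_of_left hi).symm
    have hσ : σ.IsCycle := ⟨Classical.arbitrary ι, hne _, fun j _ ↦ h _ j⟩
    have hs : σ.support = Finset.univ := by ext; simp [hne]
    rw [hσ.sign, hs, Finset.card_univ, pow_succ, mul_neg_one]

/-- The sign of a permutation in terms of its number of orbits, the orbits being the fibres
of a map `c`. -/
theorem sign_eq_pow_card_add_card_image [Fintype ι] [DecidableEq ι] [DecidableEq κ]
    (σ : Perm ι) (c : ι → κ) (h : ∀ i j, c i = c j ↔ σ.SameCycle i j) :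
    sign σ = (-1) ^ (Fintype.card ι + (Finset.univ.image c).card) := by
  induction hn : Fintype.card ι using Nat.strong_induction_on generalizing ι with
  | _ n ih =>
  obtain hι | ⟨⟨i₀⟩⟩ := isEmpty_or_nonempty ι
  · subst hn
    simp [Subsingleton.elim σ 1]
  · let p : ι → Prop := fun i ↦ c i = c i₀
    have hσ (i : ι) : c (σ i) = c i := (h _ _).2 (sameCycle_apply_left.2 .rfl)
    have hp (i : ι) : p (σ i) ↔ p i := by simp [p, hσ]
    have hnp (i : ι) : ¬ p (σ i) ↔ ¬ p i := not_congr (hp i)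
    have hdecomp : σ = (σ.subtypePerm hp).subtypeCongr (σ.subtypePerm hnp) := by
      ext i
      by_cases hi : p i
      · simp [Perm.subtypeCongr.left_apply _ _ hi]
      · simp [Perm.subtypeCongr.right_apply _ _ hi]
    have : Nonempty { i // p i } := ⟨⟨i₀, rfl⟩⟩
    have hcard := Fintype.card_subtype_compl p
    have hpos : 0 < Fintype.card { i // p i } := Fintype.card_pos
    have hle := Fintype.card_subtype_le p
    have h₁ := sign_of_forall_sameCycle (σ.subtypePerm hp) fun i j ↦
      sameCycle_subtypePerm.2 ((h _ _).1 (i.2.trans j.2.symm))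
    have h₂ := ih (Fintype.card { i // ¬ p i }) (by omega) (σ.subtypePerm hnp)
      (fun i ↦ c i) (fun i j ↦ (h _ _).trans sameCycle_subtypePerm.symm) rfl
    have himage : Finset.univ.image c =
        insert (c i₀) (Finset.univ.image fun i : { i // ¬ p i } ↦ c i) := by
      ext k
      simp only [Finset.mem_image, Finset.mem_univ, true_and, Finset.mem_insert, Subtype.exists,
        exists_prop, p]
      grind
    rw [himage, Finset.card_insert_of_notMem, hdecomp, sign_subtypeCongr, h₁, h₂, ← pow_add]
    · congr 1
      omega
    · simp [p]

end Equiv.Perm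

namespace FiniteField

open Polynomial

variable {F L : Type*} [Field F] [Fintype F] [Field L] [Algebra F L]

/-- Conjugate elements over a finite field are related by a power of Frobenius. -/
theorem exists_eq_pow_of_minpoly_eq [Normal F L] {a b : L} (h : minpoly F a = minpoly F b) :
    ∃ n : ℕ, b = a ^ Fintype.card F ^ n := by
  obtain ⟨g, rfl⟩ := (Normal.minpoly_eq_iff_mem_orbit L).1 h.symm
  have ha : IsIntegral F a := Normal.isIntegral inferInstance a
  have : FiniteDimensional F (IntermediateField.adjoin F {a}) :=
    IntermediateField.adjoin.finiteDimensional ha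
  have : Finite (IntermediateField.adjoin F {a}) := Module.finite_of_finite F
  obtain ⟨p, _⟩ := CharP.exists F
  have : Fact p.Prime := ⟨CharP.char_is_prime F p⟩
  obtain ⟨n, hn⟩ := exists_forall_apply_eq_pow F p (IntermediateField.adjoin F {a})
    (g.restrictNormal _)
  refine ⟨n, ?_⟩
  have := g.restrictNormal_commutes (IntermediateField.adjoin F {a})
    (IntermediateField.AdjoinSimple.gen F a)
  rw [hn] at this
  simpa using this.symm

theorem minpoly_pow_card_pow [Normal F L] (a : L) (n : ℕ) :
    minpoly F (a ^ Fintype.card F ^ n) = minpoly F a := by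
  have h := congr_fun (coe_frobeniusAlgEquivOfAlgebraic_iterate F L n) a
  rw [← AlgEquiv.coe_pow] at h
  simpa only [← h] using minpoly.algEquiv_eq _ a

/-- If Frobenius permutes the family `γ` through `σ`, then conjugacy classes are the cycles
of `σ`. -/
theorem minpoly_eq_iff_sameCycle [Normal F L] {ι : Type*} [Finite ι] {γ : ι → L}
    (hγ : Function.Injective γ) {σ : Equiv.Perm ι} (hσ : ∀ i, γ (σ i) = γ i ^ Fintype.card F)
    (i j : ι) : minpoly F (γ i) = minpoly F (γ j) ↔ σ.SameCycle i j := by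
  have hpow (n : ℕ) : γ ((σ ^ n) i) = γ i ^ Fintype.card F ^ n := by
    induction n with
    | zero => simp
    | succ n ih => rw [pow_succ', Equiv.Perm.mul_apply, hσ, ih, ← pow_mul, ← pow_succ]
  constructor
  · intro h
    obtain ⟨n, hn⟩ := exists_eq_pow_of_minpoly_eq h
    exact ⟨n, hγ (by rw [zpow_natCast, hpow, hn])⟩
  · intro h
    obtain ⟨n, rfl⟩ := h.exists_nat_pow_eq
    rw [hpow, minpoly_pow_card_pow]

/-- Frobenius permutes the roots of a polynomial with coefficients in a finite field. -/
theorem exists_perm_apply_eq_pow_card {ι : Type*} [Fintype ι] {γ : ι → L}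
    (hγ : Function.Injective γ) {f : F[X]} (hroots : ∀ a : L, aeval a f = 0 ↔ ∃ i, γ i = a) :
    ∃ σ : Equiv.Perm ι, ∀ i, γ (σ i) = γ i ^ Fintype.card F := by
  have hex (i : ι) : ∃ j, γ j = γ i ^ Fintype.card F := by
    rw [← hroots, ← frobeniusAlgHom_apply, aeval_algHom_apply, (hroots _).2 ⟨i, rfl⟩, map_zero]
  choose s hs using hex
  have hinj : Function.Injective s := fun i j hij ↦ hγ <|
      (frobeniusAlgHom F L).toRingHom.injective <| by
    change γ i ^ Fintype.card F = γ j ^ Fintype.card F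
    rw [← hs, ← hs, hij]
  exact ⟨Equiv.ofBijective s (Finite.injective_iff_bijective.1 hinj), hs⟩

/-- Stickelberger's theorem: the discriminant is a square in `F` exactly when Frobenius acts on the
roots by an even permutation. -/
theorem quadraticChar_eq_sign [DecidableEq F] (hF : ringChar F ≠ 2) {n : ℕ} {γ : Fin n → L}
    (hγ : Function.Injective γ) {σ : Equiv.Perm (Fin n)}
    (hσ : ∀ i, γ (σ i) = γ i ^ Fintype.card F) {d : F}
    (hd : algebraMap F L d = (Matrix.vandermonde γ).det ^ 2) :
    quadraticChar F d = Equiv.Perm.sign σ := by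
  set δ := (Matrix.vandermonde γ).det with hδ
  have hδ0 : δ ≠ 0 := Matrix.det_vandermonde_ne_zero_iff.2 hγ
  have hδq : δ ^ Fintype.card F = ((Equiv.Perm.sign σ : ℤ) : L) * δ := by
    rw [hδ, ← Matrix.det_permute, ← frobeniusAlgHom_apply F, AlgHom.map_det]
    congr 1
    ext i j
    simp [Matrix.vandermonde_apply, hσ, ← pow_mul, mul_comm]
  have hodd := FiniteField.odd_card_of_char_ne_two hF
  have hd0 : d ≠ 0 := by
    rintro rfl
    exact pow_ne_zero 2 hδ0 (by simpa using hd.symm)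
  have hpow : d ^ (Fintype.card F / 2) = ((Equiv.Perm.sign σ : ℤ) : F) := by
    apply (algebraMap F L).injective
    apply mul_right_cancel₀ hδ0
    rw [map_pow, hd, ← pow_mul, ← pow_succ, map_intCast, ← hδq]
    congr 1
    omega
  rw [quadraticChar_eq_pow_of_char_ne_two hF hd0, hpow]
  have h1 : (-1 : F) ≠ 1 := Ring.neg_one_ne_one_of_char_ne_two hF
  rcases Int.units_eq_one_or (Equiv.Perm.sign σ) with h | h <;> simp [h, h1]

end FiniteField

namespace Polynomial

/-- The monic irreducible factors of `f` are the minimal polynomials of its roots. -/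
theorem toFinset_normalizedFactors_eq_image_minpoly {F L ι : Type*} [Field F] [DecidableEq F]
    [Field L] [IsAlgClosed L] [Algebra F L] [Fintype ι] {γ : ι → L} {f : F[X]} (hf : f ≠ 0)
    (hroots : ∀ a : L, aeval a f = 0 ↔ ∃ i, γ i = a) :
    (UniqueFactorizationMonoid.normalizedFactors f).toFinset =
      Finset.univ.image fun i ↦ minpoly F (γ i) := by
  ext P
  rw [Multiset.mem_toFinset, Polynomial.mem_normalizedFactors_iff hf]
  simp only [Finset.mem_image, Finset.mem_univ, true_and]
  constructor
  · rintro ⟨hirr, hmonic, Q, rfl⟩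
    obtain ⟨a, ha⟩ := IsAlgClosed.exists_aeval_eq_zero L P hirr.degree_pos.ne'
    obtain ⟨i, rfl⟩ := (hroots a).1 (by simp [ha])
    exact ⟨i, (minpoly.eq_of_irreducible_of_monic hirr ha hmonic).symm⟩
  · rintro ⟨i, rfl⟩
    have hi : aeval (γ i) f = 0 := (hroots _).2 ⟨i, rfl⟩
    have hint : IsIntegral F (γ i) := IsAlgebraic.isIntegral ⟨f, hf, hi⟩
    exact ⟨minpoly.irreducible hint, minpoly.monic hint, minpoly.dvd F _ hi⟩

end Polynomial

/-- **Pellet's formula**: for `f ∈ F_q[u]` with `q` odd,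
`μ(f) = (-1)^{deg f} · χ₂(Δ(f))`, where `Δ(f) = ∏_{i<j} (γ_i - γ_j)²` is the discriminant
of `f` (computed from the roots `γ_i` of `f` in an algebraic closure) and `χ₂` is the
quadratic character of `F_q`. -/
theorem pellet_formula (F : Type*) [Field F] [Fintype F] [DecidableEq F]
    (hq : Odd (Fintype.card F)) (f : Polynomial F) (hf : f ≠ 0)
    (γ : Fin f.natDegree → AlgebraicClosure F)
    (hγ : f.map (algebraMap F (AlgebraicClosure F)) =
      Polynomial.C (algebraMap F (AlgebraicClosure F) f.leadingCoeff) *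
        ∏ i, (Polynomial.X - Polynomial.C (γ i)))
    (d : F)
    (hd : algebraMap F (AlgebraicClosure F) d =
      ∏ i : Fin f.natDegree, ∏ j ∈ Finset.univ.filter (fun j => i < j), (γ i - γ j) ^ 2) :
    polyMoebius f = (-1) ^ f.natDegree * quadraticChar F d := by
  have hlc : algebraMap F (AlgebraicClosure F) f.leadingCoeff ≠ 0 := by simpa using hf
  have hroots (a : AlgebraicClosure F) : Polynomial.aeval a f = 0 ↔ ∃ i, γ i = a := by
    rw [← Polynomial.eval_map_algebraMap, hγ]
    simp [hf, Polynomial.eval_prod, Finset.prod_eq_zero_iff, sub_eq_zero, eq_comm (a := a)]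
  have haroots : f.aroots (AlgebraicClosure F) = Finset.univ.val.map γ := by
    rw [Polynomial.aroots_def, hγ, Polynomial.roots_C_mul _ hlc]
    simpa only [Finset.prod, Multiset.map_map, Function.comp_def] using
      Polynomial.roots_multiset_prod_X_sub_C (Finset.univ.val.map γ)
  have hsq : Squarefree f ↔ Function.Injective γ := by
    rw [← PerfectField.separable_iff_squarefree,
      ← Polynomial.nodup_aroots_iff_of_splits hf
        (IsAlgClosed.splits (f.map (algebraMap F (AlgebraicClosure F)))), haroots]
    exact ⟨fun h i j ↦ Multiset.inj_on_of_nodup_map h i (Finset.mem_univ i) j (Finset.mem_univ j),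
      fun h ↦ Finset.univ.nodup.map h⟩
  have hd' : algebraMap F (AlgebraicClosure F) d = (Matrix.vandermonde γ).det ^ 2 := by
    rw [hd, Matrix.det_vandermonde, ← Finset.prod_pow]
    refine Finset.prod_congr rfl fun i _ ↦ ?_
    rw [← Finset.prod_pow]
    refine Finset.prod_congr (by ext; simp) fun j _ ↦ ?_
    ring
  have hF : ringChar F ≠ 2 := fun h ↦ by
    have := FiniteField.even_card_of_char_two h
    grind
  by_cases hinj : Function.Injective γ
  · obtain ⟨σ, hσ⟩ := FiniteField.exists_perm_apply_eq_pow_card hinj hroots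
    have hnodup := (UniqueFactorizationMonoid.squarefree_iff_nodup_normalizedFactors hf).1
      (hsq.2 hinj)
    rw [polyMoebius, if_pos (hsq.2 hinj), FiniteField.quadraticChar_eq_sign hF hinj hσ hd',
      Equiv.Perm.sign_eq_pow_card_add_card_image σ _
        (FiniteField.minpoly_eq_iff_sameCycle hinj hσ),
      ← Polynomial.toFinset_normalizedFactors_eq_image_minpoly hf hroots,
      Multiset.toFinset_card_of_nodup hnodup, UniqueFactorizationMonoid.normalizedFactors,
      Multiset.card_map, Fintype.card_fin]
    push_cast
    rw [← pow_add, ← add_assoc, pow_add, Even.neg_one_pow ⟨_, rfl⟩, one_mul]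
  · have hd0 : d = 0 := by
      rw [← map_eq_zero (algebraMap F (AlgebraicClosure F)), hd',
        not_not.1 (mt Matrix.det_vandermonde_ne_zero_iff.1 hinj), zero_pow two_ne_zero]
    rw [polyMoebius, if_neg (mt hsq.1 hinj), hd0, MulChar.map_zero, mul_zero]
end

section
/- For integers γ ≤ δ, the stabilizer in SL₂(F_q[u]) of the standard valuation v_{γ,δ}(x,y) = max(γ + deg x, δ + deg y) (under the action (v ⋆ M)(x,y) = v((x,y)Mᵀ)) has exactly q³ - q elements if γ = δ, and exactly (q-1)·q^{δ-γ+1} elements if γ < δ. When γ = δ the stabilizer is SL₂(F_q), and when γ < δ it consists of upper triangular matrices with diagonal (λ, λ^{-1}), λ ∈ F_q^×, and upper-right entry of degree ≤ δ - γ. -/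
/-- The degree of a polynomial, as an element of `ℤ ∪ {-∞}`. -/
noncomputable def degZ {F : Type*} [Field F] (x : Polynomial F) : WithBot ℤ :=
  x.degree.map fun n : ℕ => (n : ℤ)

/-- The standard valuation `v_{γ,δ}(x,y) = max(γ + deg x, δ + deg y)` on `F_q[u]²`. -/
noncomputable def stdVal {F : Type*} [Field F] (γ δ : ℤ) (x y : Polynomial F) : WithBot ℤ :=
  max ((γ : WithBot ℤ) + degZ x) ((δ : WithBot ℤ) + degZ y)

/-- The stabilizer of the standard valuation `v_{γ,δ}` in `SL₂(F_q[u])` under the action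
`(v ⋆ M)(x,y) = v((x,y)Mᵀ)`. -/
def valStabilizer (F : Type*) [Field F] (γ δ : ℤ) :
    Set (Matrix (Fin 2) (Fin 2) (Polynomial F)) :=
  {M | M.det = 1 ∧ ∀ x y : Polynomial F,
    stdVal γ δ (M 0 0 * x + M 0 1 * y) (M 1 0 * x + M 1 1 * y) = stdVal γ δ x y}

section DegZ

variable {F : Type*} [Field F]

theorem degZ_zero : degZ (0 : Polynomial F) = ⊥ := by
  simp [degZ]

theorem degZ_one : degZ (1 : Polynomial F) = ((0 : ℤ) : WithBot ℤ) := by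
  simp only [degZ, Polynomial.degree_one]
  rfl

theorem degZ_le_degZ_iff {x y : Polynomial F} : degZ x ≤ degZ y ↔ x.degree ≤ y.degree := by
  unfold degZ
  cases x.degree <;> cases y.degree <;> simp

theorem degZ_le_natCast_iff {x : Polynomial F} {n : ℕ} :
    degZ x ≤ ((n : ℤ) : WithBot ℤ) ↔ x.degree ≤ (n : WithBot ℕ) := by
  unfold degZ
  cases x.degree with
  | bot => simp
  | coe k => simp only [WithBot.map_coe, WithBot.coe_le_coe, Nat.cast_le, Nat.cast_withBot]

theorem degZ_le_of_neg {x : Polynomial F} {n : ℤ} (hn : n < 0)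
    (hx : degZ x ≤ (n : WithBot ℤ)) : x = 0 := by
  rw [← Polynomial.degree_eq_bot]
  unfold degZ at hx
  cases h : x.degree with
  | bot => rfl
  | coe k =>
    rw [h, WithBot.map_coe, WithBot.coe_le_coe] at hx
    omega

theorem degZ_le_zero_iff {x : Polynomial F} :
    degZ x ≤ ((0 : ℤ) : WithBot ℤ) ↔ ∃ t : F, x = Polynomial.C t := by
  rw [show (0 : ℤ) = ((0 : ℕ) : ℤ) from rfl, degZ_le_natCast_iff]
  refine ⟨fun h => ⟨_, Polynomial.eq_C_of_degree_le_zero h⟩, ?_⟩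
  rintro ⟨t, rfl⟩
  exact Polynomial.degree_C_le

theorem degZ_mul (x y : Polynomial F) : degZ (x * y) = degZ x + degZ y := by
  unfold degZ
  rw [Polynomial.degree_mul]
  cases x.degree <;> cases y.degree <;> simp [← WithBot.coe_add]

theorem degZ_neg (x : Polynomial F) : degZ (-x) = degZ x := by
  simp [degZ]

theorem degZ_add_le (x y : Polynomial F) : degZ (x + y) ≤ max (degZ x) (degZ y) := by
  rw [le_max_iff, degZ_le_degZ_iff, degZ_le_degZ_iff, ← le_max_iff]
  exact Polynomial.degree_add_le x y

theorem add_degZ_mul_le {α β : ℤ} {a : Polynomial F}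
    (ha : degZ a ≤ ((β - α : ℤ) : WithBot ℤ)) (x : Polynomial F) :
    (α : WithBot ℤ) + degZ (a * x) ≤ (β : WithBot ℤ) + degZ x := by
  rw [degZ_mul, ← add_assoc]
  refine add_le_add_left ((add_le_add_right ha _).trans ?_) _
  rw [← WithBot.coe_add, add_sub_cancel]

theorem add_degZ_add_le (α : ℤ) (x y : Polynomial F) :
    (α : WithBot ℤ) + degZ (x + y) ≤
      max ((α : WithBot ℤ) + degZ x) ((α : WithBot ℤ) + degZ y) := by
  rw [max_add_add_left]
  exact add_le_add_right (degZ_add_le x y) _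

end DegZ

section Stabilizer

variable {F : Type*} [Field F]

theorem stdVal_mul_le {γ δ : ℤ} {a b c d : Polynomial F}
    (ha : degZ a ≤ ((0 : ℤ) : WithBot ℤ)) (hb : degZ b ≤ ((δ - γ : ℤ) : WithBot ℤ))
    (hc : degZ c ≤ ((γ - δ : ℤ) : WithBot ℤ)) (hd : degZ d ≤ ((0 : ℤ) : WithBot ℤ))
    (x y : Polynomial F) :
    stdVal γ δ (a * x + b * y) (c * x + d * y) ≤ stdVal γ δ x y := by
  rw [← sub_self γ] at ha
  rw [← sub_self δ] at hd
  exact max_le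
    ((add_degZ_add_le γ _ _).trans (max_le_max (add_degZ_mul_le ha x) (add_degZ_mul_le hb y)))
    ((add_degZ_add_le δ _ _).trans (max_le_max (add_degZ_mul_le hc x) (add_degZ_mul_le hd y)))

theorem degZ_le_of_add_le {α β : ℤ} {x : Polynomial F}
    (h : (α : WithBot ℤ) + degZ x ≤ (β : WithBot ℤ)) : degZ x ≤ ((β - α : ℤ) : WithBot ℤ) := by
  cases hx : degZ x with
  | bot => exact bot_le
  | coe k =>
    rw [hx, ← WithBot.coe_add, WithBot.coe_le_coe] at h
    rw [WithBot.coe_le_coe]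
    omega

/-- Membership in the stabilizer amounts to determinant one and degree bounds on the entries. -/
theorem mem_valStabilizer_iff {γ δ : ℤ} {M : Matrix (Fin 2) (Fin 2) (Polynomial F)} :
    M ∈ valStabilizer F γ δ ↔ M.det = 1 ∧
      degZ (M 0 0) ≤ ((0 : ℤ) : WithBot ℤ) ∧ degZ (M 0 1) ≤ ((δ - γ : ℤ) : WithBot ℤ) ∧
      degZ (M 1 0) ≤ ((γ - δ : ℤ) : WithBot ℤ) ∧ degZ (M 1 1) ≤ ((0 : ℤ) : WithBot ℤ) := by
  refine and_congr_right fun hdet => ⟨fun h => ?_, ?_⟩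
  · have h₁ := (h 1 0).le
    have h₂ := (h 0 1).le
    simp only [stdVal, mul_one, mul_zero, add_zero, zero_add, degZ_zero, degZ_one, WithBot.add_bot,
      max_bot_left, max_bot_right, ← WithBot.coe_add, max_le_iff] at h₁ h₂
    rw [← sub_self γ]
    refine ⟨degZ_le_of_add_le h₁.1, degZ_le_of_add_le h₂.1, degZ_le_of_add_le h₁.2, ?_⟩
    rw [sub_self, ← sub_self δ]
    exact degZ_le_of_add_le h₂.2
  · rintro ⟨ha, hb, hc, hd⟩ x y
    refine (stdVal_mul_le ha hb hc hd x y).antisymm ?_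
    rw [Matrix.det_fin_two] at hdet
    have key := stdVal_mul_le hd ((degZ_neg _).trans_le hb) ((degZ_neg _).trans_le hc) ha
      (M 0 0 * x + M 0 1 * y) (M 1 0 * x + M 1 1 * y)
    convert key using 2
    · linear_combination -x * hdet
    · linear_combination -y * hdet

theorem valStabilizer_self (γ : ℤ) :
    valStabilizer F γ γ =
      {M : Matrix (Fin 2) (Fin 2) (Polynomial F) |
        M.det = 1 ∧ ∀ i j : Fin 2, ∃ t : F, M i j = Polynomial.C t} := by
  ext M
  rw [mem_valStabilizer_iff, sub_self]
  simp only [degZ_le_zero_iff, Set.mem_ofPred_eq, Fin.forall_fin_two, and_assoc]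

theorem valStabilizer_of_lt {γ δ : ℤ} (h : γ < δ) :
    valStabilizer F γ δ =
      {M : Matrix (Fin 2) (Fin 2) (Polynomial F) |
        ∃ (lam : F) (f : Polynomial F), lam ≠ 0 ∧
          degZ f ≤ ((δ - γ : ℤ) : WithBot ℤ) ∧
          M = !![Polynomial.C lam, f; 0, Polynomial.C lam⁻¹]} := by
  ext M
  rw [mem_valStabilizer_iff, Set.mem_ofPred_eq]
  constructor
  · rintro ⟨hdet, ha, hb, hc, hd⟩
    obtain ⟨s, hs⟩ := degZ_le_zero_iff.1 ha
    obtain ⟨t, ht⟩ := degZ_le_zero_iff.1 hd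
    have hc' := degZ_le_of_neg (by omega) hc
    rw [Matrix.det_fin_two, hs, ht, hc', mul_zero, sub_zero, ← Polynomial.C_mul,
      ← Polynomial.C_1, Polynomial.C_inj] at hdet
    refine ⟨s, M 0 1, left_ne_zero_of_mul_eq_one hdet, hb, ?_⟩
    rw [← eq_inv_of_mul_eq_one_right hdet, ← hs, ← ht, ← hc']
    exact Matrix.eta_fin_two M
  · rintro ⟨s, f, hs, hf, rfl⟩
    refine ⟨?_, degZ_le_zero_iff.2 ⟨s, rfl⟩, hf, ?_, degZ_le_zero_iff.2 ⟨s⁻¹, rfl⟩⟩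
    · rw [Matrix.det_fin_two_of, mul_zero, sub_zero, ← Polynomial.C_mul, mul_inv_cancel₀ hs,
        Polynomial.C_1]
    · exact degZ_zero.trans_le bot_le

end Stabilizer

section Counting

variable (F : Type*) [Field F] [Fintype F]

theorem card_specialLinearGroup_fin_two :
    Nat.card (Matrix.SpecialLinearGroup (Fin 2) F) = Fintype.card F ^ 3 - Fintype.card F := by
  have hrange : (Matrix.SpecialLinearGroup.toGL (n := Fin 2) (R := F)).range =
      (Matrix.GeneralLinearGroup.det (n := Fin 2) (R := F)).ker :=
    SetLike.coe_injective (Matrix.SpecialLinearGroup.range_toGL (n := Fin 2) (A := F))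
  have hcard := (Matrix.GeneralLinearGroup.det (n := Fin 2) (R := F)).ker.card_mul_index
  rw [Subgroup.index_ker, ← hrange,
    MonoidHom.range_eq_top.2 Matrix.GeneralLinearGroup.det_surjective, Subgroup.card_top,
    ← Nat.card_congr
      (MonoidHom.ofInjective Matrix.SpecialLinearGroup.toGL_injective).toEquiv,
    Matrix.card_GL_field, Fin.prod_univ_two, Nat.card_units, Nat.card_eq_fintype_card (α := F)] at hcard
  obtain ⟨k, hk⟩ : ∃ k, Fintype.card F = k + 2 :=
    Nat.exists_eq_add_of_le' (Fintype.one_lt_card (α := F))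
  simp only [hk, Fin.val_zero, Fin.val_one, pow_zero, pow_one] at hcard ⊢
  have h₁ : (k + 2) ^ 2 - 1 = (k + 1) * (k + 3) := Nat.sub_eq_of_eq_add (by ring)
  have h₂ : (k + 2) ^ 2 - (k + 2) = (k + 1) * (k + 2) := Nat.sub_eq_of_eq_add (by ring)
  have h₃ : (k + 2) ^ 3 - (k + 2) = (k + 1) * (k + 2) * (k + 3) := Nat.sub_eq_of_eq_add (by ring)
  rw [h₁, h₂, show k + 2 - 1 = k + 1 from rfl] at hcard
  rw [h₃]
  exact Nat.eq_of_mul_eq_mul_right (Nat.add_pos_right k one_pos) (hcard.trans (by ring))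

theorem ncard_constant_det_one :
    {M : Matrix (Fin 2) (Fin 2) (Polynomial F) |
      M.det = 1 ∧ ∀ i j : Fin 2, ∃ t : F, M i j = Polynomial.C t}.ncard =
      Fintype.card F ^ 3 - Fintype.card F := by
  let φ : Matrix.SpecialLinearGroup (Fin 2) F → Matrix (Fin 2) (Fin 2) (Polynomial F) :=
    fun A => A.1.map Polynomial.C
  have hφ : Function.Injective φ := fun A B h =>
    Subtype.ext (Matrix.map_injective Polynomial.C_injective h)
  have hdet (A : Matrix (Fin 2) (Fin 2) F) :
      (A.map Polynomial.C).det = Polynomial.C A.det :=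
    (RingHom.map_det Polynomial.C A).symm
  have hset : {M : Matrix (Fin 2) (Fin 2) (Polynomial F) |
      M.det = 1 ∧ ∀ i j : Fin 2, ∃ t : F, M i j = Polynomial.C t} = Set.range φ := by
    ext M
    constructor
    · rintro ⟨h, hM⟩
      choose A hA using hM
      have hMA : M = (Matrix.of A).map Polynomial.C := Matrix.ext hA
      rw [hMA, hdet, ← Polynomial.C_1, Polynomial.C_inj] at h
      exact ⟨⟨Matrix.of A, h⟩, hMA.symm⟩
    · rintro ⟨A, rfl⟩
      exact ⟨by rw [hdet, A.2, Polynomial.C_1], fun i j => ⟨A.1 i j, rfl⟩⟩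
  rw [hset, ← Nat.card_coe_set_eq, Nat.card_range_of_injective hφ,
    card_specialLinearGroup_fin_two]

theorem ncard_upper_triangular (n : ℕ) :
    {M : Matrix (Fin 2) (Fin 2) (Polynomial F) |
      ∃ (lam : F) (f : Polynomial F), lam ≠ 0 ∧ degZ f ≤ ((n : ℤ) : WithBot ℤ) ∧
        M = !![Polynomial.C lam, f; 0, Polynomial.C lam⁻¹]}.ncard =
      (Fintype.card F - 1) * Fintype.card F ^ (n + 1) := by
  let φ : Fˣ × Polynomial.degreeLT F (n + 1) → Matrix (Fin 2) (Fin 2) (Polynomial F) :=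
    fun p => !![Polynomial.C (p.1 : F), p.2.1; 0, Polynomial.C (p.1 : F)⁻¹]
  have hφ : Function.Injective φ := fun p q h =>
    Prod.ext (Units.ext (Polynomial.C_injective (congrFun₂ h 0 0)))
      (Subtype.ext (congrFun₂ h 0 1))
  have hset : {M : Matrix (Fin 2) (Fin 2) (Polynomial F) |
      ∃ (lam : F) (f : Polynomial F), lam ≠ 0 ∧ degZ f ≤ ((n : ℤ) : WithBot ℤ) ∧
        M = !![Polynomial.C lam, f; 0, Polynomial.C lam⁻¹]} = Set.range φ := by
    have hmem (f : Polynomial F) :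
        degZ f ≤ ((n : ℤ) : WithBot ℤ) ↔ f ∈ Polynomial.degreeLT F (n + 1) := by
      rw [degZ_le_natCast_iff, Polynomial.mem_degreeLT, Polynomial.degree_le_iff_coeff_zero,
        Polynomial.degree_lt_iff_coeff_zero]
      simp only [Nat.cast_lt, Nat.succ_le_iff]
    ext M
    constructor
    · rintro ⟨s, f, hs, hf, rfl⟩
      exact ⟨(Units.mk0 s hs, ⟨f, (hmem f).1 hf⟩), rfl⟩
    · rintro ⟨⟨s, f, hf⟩, rfl⟩
      exact ⟨s, f, s.ne_zero, (hmem f).2 hf, rfl⟩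
  rw [hset, ← Nat.card_coe_set_eq, Nat.card_range_of_injective hφ, Nat.card_prod,
    Nat.card_congr (Polynomial.degreeLTEquiv F (n + 1)).toEquiv]
  simp [Nat.card_units, Nat.card_eq_fintype_card]

end Counting

/-- For `γ ≤ δ`, the stabilizer of `v_{γ,δ}` in `SL₂(F_q[u])` is `SL₂(F_q)` when `γ = δ`
(with `q³ - q` elements), and when `γ < δ` it consists of the upper triangular matrices
with diagonal `(λ, λ⁻¹)`, `λ ∈ F_q^×`, and upper-right entry of degree `≤ δ - γ`
(with `(q-1)·q^{δ-γ+1}` elements). -/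
theorem stabilizer_of_standard_valuation (F : Type*) [Field F] [Fintype F]
    (γ δ : ℤ) (hγδ : γ ≤ δ) :
    (γ = δ →
        valStabilizer F γ δ =
            {M : Matrix (Fin 2) (Fin 2) (Polynomial F) |
              M.det = 1 ∧ ∀ i j : Fin 2, ∃ t : F, M i j = Polynomial.C t} ∧
          (valStabilizer F γ δ).ncard = Fintype.card F ^ 3 - Fintype.card F) ∧
    (γ < δ →
        valStabilizer F γ δ =
            {M : Matrix (Fin 2) (Fin 2) (Polynomial F) |
              ∃ (lam : F) (f : Polynomial F), lam ≠ 0 ∧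
                degZ f ≤ ((δ - γ : ℤ) : WithBot ℤ) ∧
                M = !![Polynomial.C lam, f; 0, Polynomial.C lam⁻¹]} ∧
          (valStabilizer F γ δ).ncard =
            (Fintype.card F - 1) * Fintype.card F ^ ((δ - γ).toNat + 1)) := by
  refine ⟨?_, fun h => ⟨valStabilizer_of_lt h, ?_⟩⟩
  · rintro rfl
    exact ⟨valStabilizer_self γ, by rw [valStabilizer_self, ncard_constant_det_one]⟩
  · rw [valStabilizer_of_lt h, ← ncard_upper_triangular,
      Int.toNat_of_nonneg (sub_nonneg.2 hγδ)]
end
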